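/- arXiv:0706.3750 — 15 statements merged into one kernel-verified Lean document; each statement's English description precedes it below -/
import Mathlib

section
/- Let E be a finite nonempty set and let N be the collection of closed sets of a convex geometry on E. Then the intervals [ex(A), A] for A ∈ N partition the Boolean lattice 2^E; that is, for every subset D ⊆ E there exists a unique A ∈ N such that ex(A) ⊆ D ⊆ A. -/
/-- `N` is the collection of closed sets of a convex geometry on the ground set `univ : Finset α`. -/
def IsConvexGeometry {α : Type*} [Fintype α] [DecidableEq α] (N : Finset (Finset α)) : Prop :=
  Finset.univ ∈ N ∧
  (∀ A ∈ N, ∀ B ∈ N, A ∩ B ∈ N) ∧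
  (∀ A ∈ N, A ≠ Finset.univ → ∃ x ∉ A, insert x A ∈ N)

/-- The set of excludable (extreme) elements of `A` with respect to the collection `N`. -/
def exSet {α : Type*} [DecidableEq α] (N : Finset (Finset α)) (A : Finset α) : Finset α :=
  A.filter (fun a => A.erase a ∈ N)

theorem stmt_0 {α : Type*} [Fintype α] [DecidableEq α] [Nonempty α]
    (N : Finset (Finset α)) (hN : IsConvexGeometry N) (D : Finset α) :
    ∃! A, A ∈ N ∧ exSet N A ⊆ D ∧ D ⊆ A := by
  obtain ⟨hU, hI, hX⟩ := hN
  obtain ⟨C, hC, hCmin⟩ := Finset.exists_min_image (N.filter (fun A => D ⊆ A)) Finset.card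
    ⟨Finset.univ, by simp [hU]⟩
  rw [Finset.mem_filter] at hC
  obtain ⟨hCN, hDC⟩ := hC
  refine ⟨C, ⟨hCN, ?_, hDC⟩, ?_⟩
  · intro a ha
    rw [exSet, Finset.mem_filter] at ha
    by_contra haD
    have h := hCmin (C.erase a) (by
      rw [Finset.mem_filter]
      refine ⟨ha.2, ?_⟩
      intro x hx
      rw [Finset.mem_erase]
      refine ⟨?_, hDC hx⟩
      rintro rfl
      exact haD hx)
    have := Finset.card_erase_lt_of_mem ha.1
    omega
  · rintro A ⟨hA, hex, hDA⟩
    have hCA : C ⊆ A := by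
      have h := hCmin (C ∩ A) (by
        rw [Finset.mem_filter]
        exact ⟨hI _ hCN _ hA, Finset.subset_inter hDC hDA⟩)
      have h2 := Finset.eq_of_subset_of_card_le Finset.inter_subset_left h
      exact Finset.inter_eq_left.mp h2
    refine Finset.Subset.antisymm ?_ hCA
    by_contra hAC
    obtain ⟨B, hB, hBmax⟩ := Finset.exists_max_image
      (N.filter (fun B => C ⊆ B ∧ ¬ A ⊆ B)) Finset.card
      ⟨C, by rw [Finset.mem_filter]; exact ⟨hCN, Finset.Subset.refl _, hAC⟩⟩
    rw [Finset.mem_filter] at hB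
    obtain ⟨hBN, hCB, hAB⟩ := hB
    obtain ⟨x, hxB, hxN⟩ := hX B hBN (by
      rintro rfl
      exact hAB (Finset.subset_univ _))
    have hAx : A ⊆ insert x B := by
      by_contra h
      have h2 := hBmax (insert x B) (by
        rw [Finset.mem_filter]
        exact ⟨hxN, hCB.trans (Finset.subset_insert _ _), h⟩)
      rw [Finset.card_insert_of_notMem hxB] at h2
      omega
    have hxA : x ∈ A := by
      by_contra h
      exact hAB ((Finset.subset_insert_iff_of_notMem h).mp hAx)
    have hE : A.erase x = A ∩ B := by
      ext y
      have := @hAx y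
      simp only [Finset.mem_erase, Finset.mem_inter, Finset.mem_insert] at *
      constructor
      · rintro ⟨h1, h2⟩
        exact ⟨h2, (this h2).resolve_left h1⟩
      · rintro ⟨h1, h2⟩
        exact ⟨fun h => hxB (h ▸ h2), h1⟩
    apply hxB
    apply hCB
    apply hDC
    apply hex
    rw [exSet, Finset.mem_filter]
    exact ⟨hxA, hE ▸ hI _ hA _ hBN⟩
end

section
/- Let E be a finite nonempty set and let N ⊆ 2^E be a collection of subsets of E such that for every subset D ⊆ E there exists a unique A ∈ N with ex(A) ⊆ D ⊆ A. Then N is the collection of closed sets of a convex geometry on E; that is, N satisfies: (N1) E ∈ N; (N2) if A, B ∈ N then A ∩ B ∈ N; (N3) for every A ∈ N with A ≠ E there is an x ∉ A such that A ∪ {x} ∈ N. -/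
theorem stmt_1 {α : Type*} [Fintype α] [DecidableEq α] [Nonempty α]
    (N : Finset (Finset α))
    (hpart : ∀ D : Finset α, ∃! A, A ∈ N ∧ exSet N A ⊆ D ∧ D ⊆ A) :
    Finset.univ ∈ N ∧
    (∀ A ∈ N, ∀ B ∈ N, A ∩ B ∈ N) ∧
    (∀ A ∈ N, A ≠ Finset.univ → ∃ x ∉ A, insert x A ∈ N) := by
  have hU : Finset.univ ∈ N := by
    obtain ⟨A, ⟨h1, h2, h3⟩, _⟩ := hpart Finset.univ
    have : A = Finset.univ := Finset.univ_subset_iff.mp h3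
    exact this ▸ h1
  have key : ∀ A ∈ N, ∀ B ∈ N, A ≠ B →
      (∃ a ∈ A, a ∉ B ∧ A.erase a ∈ N) ∨ (∃ b ∈ B, b ∉ A ∧ B.erase b ∈ N) := by
    intro A hA B hB hne
    by_contra hcon
    push Not at hcon
    obtain ⟨c1, c2⟩ := hcon
    apply hne
    refine (hpart (A ∩ B)).unique ⟨hA, ?_, Finset.inter_subset_left⟩
      ⟨hB, ?_, Finset.inter_subset_right⟩
    · intro a ha
      obtain ⟨h1, h2⟩ := Finset.mem_filter.mp ha
      refine Finset.mem_inter.mpr ⟨h1, ?_⟩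
      by_contra h3
      exact c1 a h1 h3 h2
    · intro a ha
      obtain ⟨h1, h2⟩ := Finset.mem_filter.mp ha
      refine Finset.mem_inter.mpr ⟨?_, h1⟩
      by_contra h3
      exact c2 a h1 h3 h2
  refine ⟨hU, ?_, ?_⟩
  · have main : ∀ n : ℕ, ∀ A ∈ N, ∀ B ∈ N, A.card + B.card = n → A ∩ B ∈ N := by
      intro n
      induction n using Nat.strong_induction_on with
      | _ n ih =>
        intro A hA B hB hn
        by_cases hne : A = B
        · subst hne
          simpa using hA
        · rcases key A hA B hB hne with ⟨a, ha, hab, hN⟩ | ⟨b, hb, hba, hN⟩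
          · have hlt := Finset.card_erase_lt_of_mem ha
            have := ih _ (by omega) _ hN B hB rfl
            have e : A.erase a ∩ B = A ∩ B := by clear * - hab; ext x; grind
            rwa [e] at this
          · have hlt := Finset.card_erase_lt_of_mem hb
            have := ih _ (by omega) A hA _ hN rfl
            have e : A ∩ B.erase b = A ∩ B := by clear * - hba; ext x; grind
            rwa [e] at this
    intro A hA B hB
    exact main _ A hA B hB rfl
  · intro A hA hne
    have main : ∀ n : ℕ, ∀ B ∈ N, A ⊆ B → A ≠ B → B.card = n → ∃ x ∉ A, insert x A ∈ N := by
      intro n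
      induction n using Nat.strong_induction_on with
      | _ n ih =>
        intro B hB hAB hne hn
        rcases key A hA B hB hne with ⟨a, ha, hab, hN⟩ | ⟨b, hb, hba, hN⟩
        · exact absurd (hAB ha) hab
        · by_cases h : A = B.erase b
          · refine ⟨b, hba, ?_⟩
            rw [h, Finset.insert_erase hb]
            exact hB
          · have hlt := Finset.card_erase_lt_of_mem hb
            exact ih _ (by omega) _ hN (Finset.subset_erase.mpr ⟨hAB, hba⟩) h rfl
    exact main _ _ hU (Finset.subset_univ A) hne rfl
end

section
/- Let E be a finite nonempty set, let N be the collection of closed sets of a convex geometry on E, and let (p_i)_{i∈E} and (q_i)_{i∈E} be real numbers with p_i + q_i = 1 for every i ∈ E. Then ∑_{A ∈ N} ( ∏_{i ∈ E\A} p_i · ∏_{j ∈ ex(A)} q_j ) = 1. -/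
theorem cg_subset {α : Type*} [Fintype α] [DecidableEq α]
    (N : Finset (Finset α)) (hN : IsConvexGeometry N) (S A B : Finset α)
    (hA : A ∈ N) (hB : B ∈ N) (h1 : exSet N A ⊆ S) (h2 : S ⊆ B) : A ⊆ B := by
  by_contra h
  obtain ⟨D, hBD, hD⟩ := Finset.exists_le_maximal (N.filter (fun D => B ⊆ D ∧ ¬ A ⊆ D))
    (a := B) (by simp [hB, h])
  have hD1 := hD.1
  simp only [Finset.mem_filter] at hD1
  obtain ⟨hDN, -, hAD⟩ := hD1
  obtain ⟨x, hx, hxN⟩ := hN.2.2 D hDN (by rintro rfl; exact hAD (Finset.subset_univ _))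
  have hAx : A ⊆ insert x D := by
    by_contra hc
    have := hD.2 (y := insert x D)
      (by simp only [Finset.mem_filter]
          exact ⟨hxN, hBD.trans (Finset.subset_insert _ _), hc⟩)
      (Finset.subset_insert _ _)
    exact hx (this (Finset.mem_insert_self _ _))
  have hxA : x ∈ A := by
    by_contra hc
    exact hAD ((Finset.subset_insert_iff_of_notMem hc).1 hAx)
  have he : A.erase x = A ∩ D := by
    ext y
    have := @hAx y
    simp only [Finset.mem_erase, Finset.mem_inter, Finset.mem_insert] at *
    grind
  have hex : x ∈ exSet N A := by
    simp only [exSet, Finset.mem_filter]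
    exact ⟨hxA, he ▸ hN.2.1 A hA D hDN⟩
  exact hx (hBD (h2 (h1 hex)))

theorem cg_exists {α : Type*} [Fintype α] [DecidableEq α]
    (N : Finset (Finset α)) (hN : IsConvexGeometry N) (S : Finset α) :
    ∃ A ∈ N, exSet N A ⊆ S ∧ S ⊆ A := by
  obtain ⟨A, -, hA⟩ := Finset.exists_le_minimal (N.filter (fun D => S ⊆ D))
    (a := Finset.univ) (by simp [hN.1])
  have hA1 := hA.1
  simp only [Finset.mem_filter] at hA1
  refine ⟨A, hA1.1, ?_, hA1.2⟩
  intro a ha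
  simp only [exSet, Finset.mem_filter] at ha
  by_contra hc
  have := hA.2 (y := A.erase a)
    (by simp only [Finset.mem_filter]
        exact ⟨ha.2, Finset.subset_erase.2 ⟨hA1.2, hc⟩⟩) (Finset.erase_subset _ _)
  exact Finset.notMem_erase a A (this ha.1)

theorem cg_interval {α : Type*} [Fintype α] [DecidableEq α]
    (X A : Finset α) (hXA : X ⊆ A)
    (p q : α → ℝ) (hpq : ∀ i, p i + q i = 1) :
    (∏ i ∈ Finset.univ \ A, p i) * ∏ j ∈ X, q j =
    ∑ S ∈ (Finset.univ : Finset α).powerset,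
      if X ⊆ S ∧ S ⊆ A then (∏ i ∈ S, q i) * ∏ i ∈ Finset.univ \ S, p i else 0 := by
  have key := Finset.prod_add (fun i => if i ∈ A then q i else 0)
    (fun i => if i ∈ X then 0 else p i) (Finset.univ : Finset α)
  trans ∏ i : α, ((if i ∈ A then q i else 0) + (if i ∈ X then 0 else p i))
  · have h1 : ∏ i ∈ Finset.univ \ A, p i = ∏ i : α, if i ∈ Finset.univ \ A then p i else 1 := by
      rw [Finset.prod_ite_mem, Finset.univ_inter]
    have h2 : ∏ i ∈ X, q i = ∏ i : α, if i ∈ X then q i else 1 := by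
      rw [Finset.prod_ite_mem, Finset.univ_inter]
    rw [h1, h2, ← Finset.prod_mul_distrib]
    refine Finset.prod_congr rfl fun i _ => ?_
    have := @hXA i
    have := hpq i
    by_cases hA : i ∈ A <;> by_cases hX : i ∈ X <;> simp_all
    linarith [hpq i]
  · rw [key]
    refine Finset.sum_congr rfl fun S _ => ?_
    split_ifs with h
    · congr 1
      · exact Finset.prod_congr rfl fun i hi => if_pos (h.2 hi)
      · exact Finset.prod_congr rfl fun i hi =>
          if_neg fun hc => (Finset.mem_sdiff.1 hi).2 (h.1 hc)
    · rw [mul_eq_zero]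
      by_cases hS : S ⊆ A
      · right
        obtain ⟨i, hi, hiS⟩ := Finset.not_subset.1 fun hc => h ⟨hc, hS⟩
        exact Finset.prod_eq_zero (i := i) (by simp [hiS]) (if_pos hi)
      · left
        obtain ⟨i, hi, hiA⟩ := Finset.not_subset.1 hS
        exact Finset.prod_eq_zero hi (if_neg hiA)

theorem stmt_2 {α : Type*} [Fintype α] [DecidableEq α] [Nonempty α]
    (N : Finset (Finset α)) (hN : IsConvexGeometry N)
    (p q : α → ℝ) (hpq : ∀ i, p i + q i = 1) :
    ∑ A ∈ N, ((∏ i ∈ Finset.univ \ A, p i) * ∏ j ∈ exSet N A, q j) = 1 := by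
  rw [Finset.sum_congr rfl fun A _ =>
    cg_interval (exSet N A) A (Finset.filter_subset _ _) p q hpq, Finset.sum_comm]
  trans ∏ i : α, (q i + p i)
  · rw [Finset.prod_add]
    refine Finset.sum_congr rfl fun S _ => ?_
    obtain ⟨A, hA, h1, h2⟩ := cg_exists N hN S
    rw [Finset.sum_eq_single A]
    · rw [if_pos ⟨h1, h2⟩]
    · intro B hB hne
      refine if_neg fun h => hne ?_
      exact (cg_subset N hN S B A hB hA h.1 h2).antisymm (cg_subset N hN S A B hA hB h1 h.2)
    · exact fun h => absurd hA h
  · exact Finset.prod_eq_one fun i _ => by rw [add_comm]; exact hpq i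
end

section
/- Let E be a finite nonempty set and let N ⊆ 2^E be a collection of subsets of E such that for every choice of real numbers (p_i)_{i∈E} and (q_i)_{i∈E} with p_i + q_i = 1 for all i ∈ E, the identity ∑_{A ∈ N} ( ∏_{i ∈ E\A} p_i · ∏_{j ∈ ex(A)} q_j ) = 1 holds. Then for every subset D ⊆ E there exists a unique A ∈ N with ex(A) ⊆ D ⊆ A. -/
theorem stmt_3 {α : Type*} [Fintype α] [DecidableEq α] [Nonempty α]
    (N : Finset (Finset α))
    (hsum : ∀ p q : α → ℝ, (∀ i, p i + q i = 1) →
      ∑ A ∈ N, ((∏ i ∈ Finset.univ \ A, p i) * ∏ j ∈ exSet N A, q j) = 1)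
    (D : Finset α) :
    ∃! A, A ∈ N ∧ exSet N A ⊆ D ∧ D ⊆ A := by
  classical
  have h := hsum (fun i => if i ∈ D then 0 else 1) (fun i => if i ∈ D then 1 else 0)
    (by intro i; by_cases hi : i ∈ D <;> simp [hi])
  have key : ∀ A ∈ N, ((∏ i ∈ Finset.univ \ A, (if i ∈ D then (0:ℝ) else 1)) *
      ∏ j ∈ exSet N A, (if j ∈ D then (1:ℝ) else 0)) =
      if exSet N A ⊆ D ∧ D ⊆ A then 1 else 0 := by
    intro A _
    split_ifs with hA
    · rw [Finset.prod_eq_one, Finset.prod_eq_one, one_mul]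
      · intro j hj
        rw [if_pos (hA.1 hj)]
      · intro i hi
        rw [if_neg]
        intro hD
        exact (Finset.mem_sdiff.1 hi).2 (hA.2 hD)
    · by_cases h1 : exSet N A ⊆ D
      · have h2 : ¬ D ⊆ A := fun h2 => hA ⟨h1, h2⟩
        obtain ⟨x, hx, hxA⟩ := Finset.not_subset.1 h2
        rw [Finset.prod_eq_zero (i := x) (by simp [hxA]) (by simp [hx]), zero_mul]
      · obtain ⟨x, hx, hxD⟩ := Finset.not_subset.1 h1
        rw [mul_comm, Finset.prod_eq_zero hx (by simp [hxD]), zero_mul]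
  rw [Finset.sum_congr rfl key, Finset.sum_boole] at h
  have h' : (N.filter (fun A => exSet N A ⊆ D ∧ D ⊆ A)).card = 1 := by exact_mod_cast h
  obtain ⟨A, hA⟩ := Finset.card_eq_one.1 h'
  have hm : ∀ B, (B ∈ N ∧ exSet N B ⊆ D ∧ D ⊆ B) ↔ B = A := by
    intro B
    rw [← Finset.mem_singleton, ← hA, Finset.mem_filter]
  exact ⟨A, (hm A).2 rfl, fun B hB => (hm B).1 hB⟩
end

section
/- Let E be a finite nonempty set and let N ⊆ 2^E be a collection of subsets with E ∈ N such that every A ∈ N is accessible from E within N. Then N is closed under pairwise intersection (equivalently, N is the collection of closed sets of a convex geometry on E) if and only if for every subset S ⊆ E there exists a unique T ∈ N such that S ⊆ T and no member T' ∈ N with T' ⊊ T satisfies S ⊆ T' (i.e., a unique minimal member of N containing S). -/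
/-- `A` is accessible from `B` within the collection `F`: there is a chain
`B = S_0 ⊋ S_1 ⊋ ⋯ ⊋ S_k = A` of members of `F` with `|S_i \ S_{i+1}| = 1`. -/
def AccessibleFrom {α : Type*} [DecidableEq α] (F : Finset (Finset α)) (B A : Finset α) : Prop :=
  ∃ (k : ℕ) (S : ℕ → Finset α), S 0 = B ∧ S k = A ∧ (∀ i ≤ k, S i ∈ F) ∧
    ∀ i < k, S (i + 1) ⊆ S i ∧ (S i \ S (i + 1)).card = 1

theorem stmt_4 {α : Type*} [Fintype α] [DecidableEq α] [Nonempty α]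
    (N : Finset (Finset α)) (hE : Finset.univ ∈ N)
    (hacc : ∀ A ∈ N, AccessibleFrom N Finset.univ A) :
    (∀ A ∈ N, ∀ B ∈ N, A ∩ B ∈ N) ↔
    (∀ S : Finset α, ∃! T, T ∈ N ∧ S ⊆ T ∧ ∀ T' ∈ N, T' ⊂ T → ¬ S ⊆ T') := by
  have key : ∀ (S A : Finset α), A ∈ N → S ⊆ A →
      ∃ T, T ⊆ A ∧ T ∈ N ∧ S ⊆ T ∧ ∀ T' ∈ N, T' ⊂ T → ¬ S ⊆ T' := by
    intro S A
    induction A using Finset.strongInduction with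
    | H A ih =>
      intro hA hS
      by_cases h : ∃ T' ∈ N, T' ⊂ A ∧ S ⊆ T'
      · obtain ⟨T', h1, h2, h3⟩ := h
        obtain ⟨T, a, b⟩ := ih T' h2 h1 h3
        exact ⟨T, a.trans h2.subset, b⟩
      · exact ⟨A, subset_rfl, hA, hS, fun T' h1 h2 h3 => h ⟨T', h1, h2, h3⟩⟩
  constructor
  · intro h S
    obtain ⟨T, -, hT, hST, hm⟩ := key S Finset.univ hE (Finset.subset_univ _)
    have aux : ∀ U V : Finset α, V ∈ N → S ⊆ V → U ∈ N → S ⊆ U →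
        (∀ T' ∈ N, T' ⊂ U → ¬ S ⊆ T') → U ⊆ V := by
      intro U V hV hSV hU hSU hmU
      by_contra hc
      refine hmU (U ∩ V) (h U hU V hV) ?_ (Finset.subset_inter hSU hSV)
      refine ⟨Finset.inter_subset_left, fun hs => hc (hs.trans Finset.inter_subset_right)⟩
    refine ⟨T, ⟨hT, hST, hm⟩, ?_⟩
    rintro U ⟨hU, hSU, hmU⟩
    exact (aux U T hT hST hU hSU hmU).antisymm (aux T U hU hSU hT hST hm)
  · intro h A hA B hB
    obtain ⟨T, hTA, hT⟩ := key (A ∩ B) A hA Finset.inter_subset_left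
    obtain ⟨U, hUB, hU⟩ := key (A ∩ B) B hB Finset.inter_subset_right
    have e : T = U := (h (A ∩ B)).unique hT hU
    subst e
    have e2 : A ∩ B = T := hT.2.1.antisymm (Finset.subset_inter hTA hUB)
    rw [e2]
    exact hT.1
end

section
/- Let E be a finite nonempty set, let N be the collection of closed sets of a convex geometry on E with closure operator τ, let (p_i)_{i∈E} and (q_i)_{i∈E} be real numbers with p_i + q_i = 1 for every i ∈ E, and let f : 2^E → ℝ be a function satisfying f(D) = f(τ(D)) for every D ⊆ E. Then ∑_{D ⊆ E} f(D) ∏_{i ∈ E\D} p_i ∏_{j ∈ D} q_j = ∑_{A ∈ N} f(A) ∏_{i ∈ E\A} p_i ∏_{j ∈ ex(A)} q_j. -/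
/-- The closure of `S`: the intersection of all members of `N` containing `S`. -/
def closure' {α : Type*} [Fintype α] [DecidableEq α] (N : Finset (Finset α)) (S : Finset α) :
    Finset α :=
  Finset.univ.filter (fun x => ∀ C ∈ N, S ⊆ C → x ∈ C)

theorem exists_ex_aux {α : Type*} [Fintype α] [DecidableEq α]
    (N : Finset (Finset α)) (hN : IsConvexGeometry N) (A B : Finset α) (hA : A ∈ N)
    (hB : B ∈ N) (hAB : ¬ A ⊆ B) : ∃ x ∈ exSet N A, x ∉ B := by
  obtain ⟨h1, h2, h3⟩ := hN
  obtain ⟨C, hC, hmax⟩ := (N.filter (fun C => B ⊆ C ∧ ¬ A ⊆ C)).exists_max_image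
    Finset.card ⟨B, by simp [hB, hAB]⟩
  simp only [Finset.mem_filter] at hC hmax
  obtain ⟨hCN, hBC, hAC⟩ := hC
  obtain ⟨x, hx, hxN⟩ := h3 C hCN (by rintro rfl; exact hAC (Finset.subset_univ _))
  have hAx : A ⊆ insert x C := by
    by_contra h
    have := hmax _ ⟨hxN, hBC.trans (Finset.subset_insert _ _), h⟩
    rw [Finset.card_insert_of_notMem hx] at this
    omega
  have hxA : x ∈ A := by
    by_contra h
    exact hAC ((Finset.subset_insert_iff_of_notMem h).1 hAx)
  refine ⟨x, ?_, fun h => hx (hBC h)⟩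
  have he : A.erase x = A ∩ C := by
    ext y
    have := @hAx y
    simp only [Finset.mem_insert, Finset.mem_erase, Finset.mem_inter] at *
    grind
  simp only [exSet, Finset.mem_filter]
  exact ⟨hxA, he ▸ h2 _ hA _ hCN⟩

theorem closure_mem_aux {α : Type*} [Fintype α] [DecidableEq α]
    (N : Finset (Finset α)) (hN : IsConvexGeometry N) (S : Finset α) : closure' N S ∈ N := by
  obtain ⟨h1, h2, h3⟩ := hN
  have key : ∀ M : Finset (Finset α), M ⊆ N →
      (Finset.univ.filter (fun x => ∀ C ∈ M, x ∈ C)) ∈ N := by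
    intro M
    induction M using Finset.induction_on with
    | empty => intro _; simpa using h1
    | insert C M _ ih =>
      intro h
      have := h2 C (h (by simp)) _ (ih ((Finset.subset_insert _ _).trans h))
      convert this using 1
      ext x
      simp
  convert key (N.filter (fun C => S ⊆ C)) (Finset.filter_subset _ _) using 1
  ext x
  simp [closure']

theorem closure_eq_iff_aux {α : Type*} [Fintype α] [DecidableEq α]
    (N : Finset (Finset α)) (hN : IsConvexGeometry N) (A D : Finset α) (hA : A ∈ N) :
    closure' N D = A ↔ exSet N A ⊆ D ∧ D ⊆ A := by
  have hsub : D ⊆ closure' N D := by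
    intro x hx
    simp only [closure', Finset.mem_filter, Finset.mem_univ, true_and]
    exact fun C _ h => h hx
  have hmin : ∀ C ∈ N, D ⊆ C → closure' N D ⊆ C := by
    intro C hC h x hx
    simp only [closure', Finset.mem_filter, Finset.mem_univ, true_and] at hx
    exact hx C hC h
  constructor
  · intro h
    rw [h] at hsub hmin
    refine ⟨fun a ha => ?_, hsub⟩
    simp only [exSet, Finset.mem_filter] at ha
    by_contra hD
    have := hmin _ ha.2 (fun y hy => Finset.mem_erase.2 ⟨by rintro rfl; exact hD hy, hsub hy⟩) ha.1
    simp at this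
  · rintro ⟨h1, h2⟩
    refine (hmin A hA h2).antisymm ?_
    by_contra h
    obtain ⟨x, hx, hxB⟩ := exists_ex_aux N hN A _ hA (closure_mem_aux N hN D) h
    exact hxB (hsub (h1 hx))

theorem sum_aux {α : Type*} [Fintype α] [DecidableEq α]
    (X A : Finset α) (hX : X ⊆ A) (p q : α → ℝ) (hpq : ∀ i, p i + q i = 1) :
    ∑ D ∈ (Finset.univ : Finset α).powerset with X ⊆ D ∧ D ⊆ A,
      ((∏ i ∈ Finset.univ \ D, p i) * ∏ j ∈ D, q j) =
    (∏ i ∈ Finset.univ \ A, p i) * ∏ j ∈ X, q j := by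
  have h := Finset.prod_add (fun i => if i ∈ A then q i else 0)
    (fun i => if i ∈ X then 0 else p i) (Finset.univ : Finset α)
  have hL : ∏ i : α, ((if i ∈ A then q i else 0) + (if i ∈ X then 0 else p i)) =
      (∏ i ∈ Finset.univ \ A, p i) * ∏ j ∈ X, q j := by
    have e1 : ∏ i ∈ Finset.univ \ A, p i = ∏ i : α, if i ∈ A then 1 else p i := by
      rw [Finset.prod_ite]
      simp only [Finset.prod_const_one, one_mul]
      congr 1
      ext; simp
    have e2 : ∏ i ∈ X, q i = ∏ i : α, if i ∈ X then q i else 1 := by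
      simp
    rw [e1, e2, ← Finset.prod_mul_distrib]
    refine Finset.prod_congr rfl fun i _ => ?_
    have := @hX i
    have := hpq i
    grind
  rw [← hL, h, Finset.sum_filter]
  refine Finset.sum_congr rfl fun D _ => ?_
  split_ifs with hD
  · rw [mul_comm]
    congr 1
    · exact Finset.prod_congr rfl fun i hi => by simp [hD.2 hi]
    · refine Finset.prod_congr rfl fun i hi => ?_
      have : i ∉ X := fun h => (Finset.mem_sdiff.1 hi).2 (hD.1 h)
      simp [this]
  · symm
    by_cases h1 : D ⊆ A
    · have h2 : ¬ X ⊆ D := fun h => hD ⟨h, h1⟩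
      obtain ⟨x, hx, hxD⟩ := Finset.not_subset.1 h2
      exact mul_eq_zero_of_right _ (Finset.prod_eq_zero (i := x) (by simp [hxD]) (by simp [hx]))
    · obtain ⟨x, hx, hxA⟩ := Finset.not_subset.1 h1
      exact mul_eq_zero_of_left (Finset.prod_eq_zero hx (by simp [hxA])) _

theorem stmt_5 {α : Type*} [Fintype α] [DecidableEq α] [Nonempty α]
    (N : Finset (Finset α)) (hN : IsConvexGeometry N)
    (p q : α → ℝ) (hpq : ∀ i, p i + q i = 1)
    (f : Finset α → ℝ) (hf : ∀ D : Finset α, f D = f (closure' N D)) :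
    ∑ D ∈ (Finset.univ : Finset α).powerset,
        f D * ((∏ i ∈ Finset.univ \ D, p i) * ∏ j ∈ D, q j) =
    ∑ A ∈ N, f A * ((∏ i ∈ Finset.univ \ A, p i) * ∏ j ∈ exSet N A, q j) := by
  rw [← Finset.sum_fiberwise_of_maps_to (t := N) (g := closure' N)
    (fun D _ => closure_mem_aux N hN D)]
  refine Finset.sum_congr rfl fun A hA => ?_
  rw [← sum_aux (exSet N A) A (Finset.filter_subset _ _) p q hpq, Finset.mul_sum]
  refine Finset.sum_congr ?_ ?_
  · ext D
    simp only [Finset.mem_filter, closure_eq_iff_aux N hN A D hA]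
  · intro D hD
    rw [hf D, (closure_eq_iff_aux N hN A D hA).2 (Finset.mem_filter.1 hD).2]
end

section
/- Let E be a finite set. A collection F ⊆ 2^E is the collection of full sets determined by some family C of rooted sets in E if and only if E ∈ F and F is closed under pairwise intersection. -/
/-- `S` is full with respect to the family `C` of rooted sets: the root of a rooted set is
never the only element of that rooted set missing from `S`. -/
def IsFull {α : Type*} [DecidableEq α] (C : Set (Finset α × α)) (S : Finset α) : Prop :=
  ∀ p ∈ C, p.1.erase p.2 ⊆ S → p.2 ∈ S

theorem stmt_6 {α : Type*} [Fintype α] [DecidableEq α] (F : Set (Finset α)) :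
    (∃ C : Set (Finset α × α), (∀ p ∈ C, p.2 ∈ p.1) ∧ F = {S | IsFull C S}) ↔
    (Finset.univ ∈ F ∧ ∀ A ∈ F, ∀ B ∈ F, A ∩ B ∈ F) := by
  constructor
  · rintro ⟨C, -, rfl⟩
    refine ⟨fun p _ _ => Finset.mem_univ _, fun A hA B hB p hp h => ?_⟩
    exact Finset.mem_inter.2 ⟨hA p hp (h.trans Finset.inter_subset_left),
      hB p hp (h.trans Finset.inter_subset_right)⟩
  · rintro ⟨hu, hi⟩
    classical
    refine ⟨{p | p.2 ∈ p.1 ∧ ∀ T ∈ F, p.1.erase p.2 ⊆ T → p.2 ∈ T}, fun p hp => hp.1, ?_⟩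
    ext S
    constructor
    · intro hS p hp h
      exact hp.2 S hS h
    · intro hS
      have key : ∀ G : Finset (Finset α), (∀ T ∈ G, T ∈ F) → G.inf id ∈ F := by
        intro G
        induction G using Finset.induction_on with
        | empty => intro _; simpa using hu
        | insert T G _ ih =>
          intro h
          rw [Finset.inf_insert]
          exact hi _ (h T (Finset.mem_insert_self _ _)) _
            (ih fun U hU => h U (Finset.mem_insert_of_mem hU))
      let G : Finset (Finset α) := Finset.univ.filter fun T => T ∈ F ∧ S ⊆ T
      have hG : G.inf id ∈ F := key G fun T hT => (Finset.mem_filter.1 hT).2.1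
      have hSG : S ≤ G.inf id := Finset.le_inf fun T hT => (Finset.mem_filter.1 hT).2.2
      have hGS : G.inf id ≤ S := by
        intro a ha
        by_contra haS
        refine haS (hS (insert a S, a) ⟨Finset.mem_insert_self _ _, ?_⟩ ?_)
        · intro T hT h
          have h' : S ⊆ T := by simpa [Finset.erase_insert haS] using h
          have : G.inf id ≤ T :=
            Finset.inf_le (f := id) (Finset.mem_filter.2 ⟨Finset.mem_univ _, hT, h'⟩)
          exact this ha
        · simp [Finset.erase_insert haS]
      rw [le_antisymm hSG hGS]
      exact hG
end

section
/- Let E be a finite nonempty set and let N be the collection of closed sets of a convex geometry on E with closure operator τ. Then for every A ∈ N, the set ex(A) of extreme points of A is the unique minimal set whose closure is A: τ(ex(A)) = A, and every S ⊆ E with τ(S) = A satisfies ex(A) ⊆ S. -/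
theorem step_aux {α : Type*} [Fintype α] [DecidableEq α]
    (N : Finset (Finset α)) (hN : IsConvexGeometry N) (A : Finset α) (hA : A ∈ N)
    (C : Finset α) (hCA : C ⊆ A) (hne : C ≠ A) :
    ∀ n : ℕ, ∀ D ∈ N, D ∩ A = C → Dᶜ.card = n → ∃ x ∈ A, x ∉ C ∧ insert x C ∈ N := by
  intro n
  induction n using Nat.strong_induction_on with
  | _ n ih =>
    intro D hD hDA hn
    have hDu : D ≠ Finset.univ := by
      rintro rfl
      apply hne
      rw [← hDA, Finset.univ_inter]
    obtain ⟨x, hx, hxN⟩ := hN.2.2 D hD hDu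
    by_cases hxA : x ∈ A
    · refine ⟨x, hxA, ?_, ?_⟩
      · rw [← hDA]
        simp [hx]
      · have h := hN.2.1 _ hxN _ hA
        rwa [Finset.insert_inter_of_mem hxA, hDA] at h
    · refine ih _ ?_ (insert x D) hxN ?_ rfl
      · rw [← hn]
        apply Finset.card_lt_card
        rw [Finset.compl_ssubset_compl]
        exact Finset.ssubset_insert hx
      · rw [Finset.insert_inter_of_notMem hxA, hDA]

theorem eq_aux {α : Type*} [Fintype α] [DecidableEq α]
    (N : Finset (Finset α)) (hN : IsConvexGeometry N) (A : Finset α) (hA : A ∈ N) :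
    ∀ n : ℕ, ∀ C ∈ N, C ⊆ A → exSet N A ⊆ C → Cᶜ.card = n → C = A := by
  intro n
  induction n using Nat.strong_induction_on with
  | _ n ih =>
    intro C hC hCA hex hn
    by_contra hne
    obtain ⟨x, hxA, hxC, hxN⟩ := step_aux N hN A hA C hCA hne _ C hC
      (Finset.inter_eq_left.mpr hCA) rfl
    have h : insert x C = A := by
      refine ih _ ?_ (insert x C) hxN (Finset.insert_subset hxA hCA)
        (hex.trans (Finset.subset_insert _ _)) rfl
      rw [← hn]
      apply Finset.card_lt_card
      rw [Finset.compl_ssubset_compl]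
      exact Finset.ssubset_insert hxC
    apply hxC
    apply hex
    rw [exSet, Finset.mem_filter]
    refine ⟨hxA, ?_⟩
    rw [← h, Finset.erase_insert hxC]
    exact hC

theorem stmt_8 {α : Type*} [Fintype α] [DecidableEq α] [Nonempty α]
    (N : Finset (Finset α)) (hN : IsConvexGeometry N) (A : Finset α) (hA : A ∈ N) :
    closure' N (exSet N A) = A ∧ ∀ S : Finset α, closure' N S = A → exSet N A ⊆ S := by
  constructor
  · ext y
    simp only [closure', Finset.mem_filter, Finset.mem_univ, true_and]
    constructor
    · intro h
      exact h A hA (Finset.filter_subset _ _)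
    · intro hy C hC hex
      have h := eq_aux N hN A hA _ (C ∩ A) (hN.2.1 _ hC _ hA) Finset.inter_subset_right
        (Finset.subset_inter hex (Finset.filter_subset _ _)) rfl
      rw [← h] at hy
      exact (Finset.mem_inter.mp hy).1
  · intro S hS a ha
    rw [exSet, Finset.mem_filter] at ha
    by_contra haS
    have hSA : S ⊆ A := by
      intro y hy
      rw [← hS]
      simp only [closure', Finset.mem_filter, Finset.mem_univ, true_and]
      exact fun C _ h => h hy
    have h1 := ha.1
    rw [← hS] at h1
    simp only [closure', Finset.mem_filter, Finset.mem_univ, true_and] at h1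
    have h2 := h1 _ ha.2 (Finset.subset_erase.mpr ⟨hSA, haS⟩)
    exact Finset.notMem_erase a A h2
end

section
/- Let E be a finite nonempty set and let N be the collection of closed sets of a convex geometry on E. If A, B ∈ N and A ⊊ B, then there exists an element x ∈ B \ A such that B \ {x} ∈ N. Consequently, every closed set is accessible from any closed superset by removing one element at a time through closed sets. -/
theorem stmt_10 {α : Type*} [Fintype α] [DecidableEq α] [Nonempty α]
    (N : Finset (Finset α)) (hN : IsConvexGeometry N) :
    (∀ A ∈ N, ∀ B ∈ N, A ⊂ B → ∃ x ∈ B \ A, B.erase x ∈ N) ∧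
    (∀ A ∈ N, ∀ B ∈ N, A ⊆ B → AccessibleFrom N B A) := by
  obtain ⟨hU, hI, hX⟩ := hN
  have key : ∀ A ∈ N, ∀ B ∈ N, A ⊂ B → ∃ x ∈ B \ A, B.erase x ∈ N := by
    intro A hA B hB hAB
    obtain ⟨C, hC, hmax⟩ := Finset.exists_max_image (N.filter (fun C => A ⊆ C ∧ ¬ B ⊆ C))
      Finset.card ⟨A, by simp [hA, hAB.2]⟩
    obtain ⟨hCN, hAC, hBC⟩ := Finset.mem_filter.1 hC
    obtain ⟨x, hx, hxN⟩ := hX C hCN (fun h => hBC (h ▸ Finset.subset_univ B))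
    have hB' : B ⊆ insert x C := by
      by_contra h
      have := hmax (insert x C) (Finset.mem_filter.2
        ⟨hxN, hAC.trans (Finset.subset_insert x C), h⟩)
      rw [Finset.card_insert_of_notMem hx] at this
      omega
    have hxB : x ∈ B := by
      by_contra h
      apply hBC
      intro y hy
      have := hB' hy
      grind
    refine ⟨x, Finset.mem_sdiff.2 ⟨hxB, fun h => hx (hAC h)⟩, ?_⟩
    have : B.erase x = B ∩ C := by
      ext y
      have := @hB' y
      grind
    rw [this]
    exact hI B hB C hCN
  refine ⟨key, ?_⟩
  intro A hA B
  induction B using Finset.strongInduction with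
  | H B ih =>
    intro hB hAB
    by_cases hEq : A = B
    · subst hEq
      exact ⟨0, fun _ => A, rfl, rfl, fun _ _ => hA, fun i hi => absurd hi (by omega)⟩
    · obtain ⟨x, hx, hxN⟩ := key A hA B hB (hAB.ssubset_of_ne hEq)
      obtain ⟨hxB, hxA⟩ := Finset.mem_sdiff.1 hx
      obtain ⟨k, S, h0, hk, hS, hstep⟩ := ih (B.erase x) (Finset.erase_ssubset hxB) hxN
        (Finset.subset_erase.2 ⟨hAB, hxA⟩)
      refine ⟨k + 1, fun i => Nat.casesOn i B S, rfl, hk, ?_, ?_⟩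
      · rintro (_ | i) hi
        · exact hB
        · exact hS i (by omega)
      · rintro (_ | i) hi
        · show S 0 ⊆ B ∧ (B \ S 0).card = 1
          rw [h0]
          refine ⟨Finset.erase_subset _ _, ?_⟩
          rw [Finset.sdiff_erase hxB]
          simp
        · exact hstep i (by omega)
end

section
/- Let E be a finite nonempty set and let N ⊆ 2^E be a collection of subsets of E such that for every D ⊆ E there exists a unique A ∈ N with ex(A) ⊆ D ⊆ A; denote this unique A by φ(D). Then for every B ∈ N and every D ⊆ B, one has φ(D) ⊆ B. -/
theorem stmt_11 {α : Type*} [Fintype α] [DecidableEq α] [Nonempty α]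
    (N : Finset (Finset α))
    (hpart : ∀ D : Finset α, ∃! A, A ∈ N ∧ exSet N A ⊆ D ∧ D ⊆ A)
    (φ : Finset α → Finset α)
    (hφ : ∀ D : Finset α, φ D ∈ N ∧ exSet N (φ D) ⊆ D ∧ D ⊆ φ D)
    (B : Finset α) (hB : B ∈ N) (D : Finset α) (hDB : D ⊆ B) :
    φ D ⊆ B := by
  induction B using Finset.strongInduction with
  | H B ih =>
    by_cases h : exSet N B ⊆ D
    · exact ((hpart D).unique (hφ D) ⟨hB, h, hDB⟩).subset
    · obtain ⟨b, hb, hbD⟩ := Finset.not_subset.mp h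
      obtain ⟨hbB, hbN⟩ := Finset.mem_filter.mp hb
      exact (ih (B.erase b) (Finset.erase_ssubset hbB) hbN
        (Finset.subset_erase.mpr ⟨hDB, hbD⟩)).trans (Finset.erase_subset _ _)
end

section
/- Let E be a finite nonempty set and let F ⊆ 2^E be a collection of subsets of E. Then F is the collection of feasible sets of an antimatroid on E if and only if F* = {E \ F : F ∈ F} is the collection of closed sets of a convex geometry on E. -/
/-- `L` is an antimatroid on the ground set `univ : Finset α`: a nonempty left-hereditary
set of simple words satisfying the exchange axiom (L2) and axiom (L3). -/
def IsAntimatroid {α : Type*} (L : Set (List α)) : Prop :=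
  L.Nonempty ∧
  (∀ w ∈ L, w.Nodup) ∧
  (∀ w v : List α, w ++ v ∈ L → w ∈ L) ∧
  (∀ w ∈ L, ∀ v ∈ L, List.length v < List.length w → ∃ x ∈ w, v ++ [x] ∈ L) ∧
  (∀ (w v : List α) (x : α), w ++ [x] ∈ L → w ++ v ∈ L → x ∉ v → w ++ v ++ [x] ∈ L)

/-- The feasible sets of a set of words: the supports of its words. -/
def FeasibleSets {α : Type*} [DecidableEq α] (L : Set (List α)) : Set (Finset α) :=
  {S | ∃ w ∈ L, w.toFinset = S}

/-- `N` is the collection of closed sets of a convex geometry on the ground set `univ`. -/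
def IsConvexGeometrySet {α : Type*} [Fintype α] [DecidableEq α] (N : Set (Finset α)) : Prop :=
  Finset.univ ∈ N ∧
  (∀ A ∈ N, ∀ B ∈ N, A ∩ B ∈ N) ∧
  (∀ A ∈ N, A ≠ Finset.univ → ∃ x ∉ A, insert x A ∈ N)

theorem aux_ext {α : Type*} [DecidableEq α] {L : Set (List α)} (h : IsAntimatroid L)
    (b : List α) (hb : b ∈ L) : ∀ (n : ℕ) (a : List α), a ∈ L → a.toFinset ⊆ b.toFinset →
      b.length = a.length + n → ∃ c, a ++ c ∈ L ∧ (a ++ c).toFinset = b.toFinset := by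
  obtain ⟨_, hN, h1, h2, h3⟩ := h
  intro n
  induction n with
  | zero =>
    intro a ha hab hl
    refine ⟨[], by simpa using ha, ?_⟩
    rw [List.append_nil]
    apply Finset.eq_of_subset_of_card_le hab
    rw [List.toFinset_card_of_nodup (hN a ha), List.toFinset_card_of_nodup (hN b hb)]
    omega
  | succ n ih =>
    intro a ha hab hl
    obtain ⟨x, hx, hax⟩ := h2 b hb a ha (by omega)
    obtain ⟨c, hc, hc'⟩ := ih (a ++ [x]) hax (by
      intro y hy
      simp only [List.toFinset_append, Finset.mem_union, List.mem_toFinset, List.mem_singleton] at hy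
      rcases hy with hy | hy
      · exact hab (by simpa using hy)
      · subst hy; simpa using hx) (by simp; omega)
    exact ⟨x :: c, by simpa using hc, by simpa using hc'⟩

theorem aux_union {α : Type*} [DecidableEq α] {L : Set (List α)} (h : IsAntimatroid L)
    (B : Finset α) (hB : B ∈ FeasibleSets L) (a : List α) :
    a ∈ L → a.toFinset ∪ B ∈ FeasibleSets L := by
  induction a using List.reverseRecOn with
  | nil => intro _; simpa using hB
  | append_singleton a x ih =>
    intro hax
    have ha := h.2.2.1 _ _ hax
    obtain ⟨b, hb, hbe⟩ := ih ha
    by_cases hx : x ∈ b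
    · refine ⟨b, hb, ?_⟩
      have hx' : x ∈ a.toFinset ∪ B := by rw [← hbe]; simpa using hx
      rw [hbe]
      ext y
      simp only [Finset.mem_union, List.mem_toFinset, List.mem_append, List.mem_singleton] at *
      grind
    · have hs : a.toFinset ⊆ b.toFinset := by rw [hbe]; exact Finset.subset_union_left
      have hl : a.length ≤ b.length := by
        have := Finset.card_le_card hs
        rwa [List.toFinset_card_of_nodup (h.2.1 a ha),
          List.toFinset_card_of_nodup (h.2.1 b hb)] at this
      obtain ⟨c, hc, hce⟩ := aux_ext h b hb (b.length - a.length) a ha hs (by omega)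
      have hxc : x ∉ c := by
        intro hxc
        apply hx
        have : x ∈ (a ++ c).toFinset := by simp [hxc]
        rw [hce] at this
        simpa using this
      refine ⟨_, h.2.2.2.2 a c x hax hc hxc, ?_⟩
      rw [List.toFinset_append, hce, hbe]
      ext y
      simp only [Finset.mem_union, List.mem_toFinset, List.mem_append, List.mem_singleton]
      tauto

theorem aux_exch {α : Type*} [DecidableEq α] {F : Set (Finset α)}
    (hU : ∀ A ∈ F, ∀ B ∈ F, A ∪ B ∈ F) (S : Finset α) (hS : S ∈ F) (w : List α) :
    (∀ p, p <+: w → p.toFinset ∈ F) → ¬ w.toFinset ⊆ S → ∃ x ∈ w, x ∉ S ∧ insert x S ∈ F := by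
  induction w using List.reverseRecOn with
  | nil => intro _ h; simp at h
  | append_singleton w x ih =>
    intro hp hn
    by_cases hw : w.toFinset ⊆ S
    · have hxS : x ∉ S := by
        intro hxS
        apply hn
        intro y hy
        simp only [List.toFinset_append, Finset.mem_union, List.mem_toFinset,
          List.mem_singleton] at hy
        rcases hy with hy | hy
        · exact hw (by simpa using hy)
        · exact hy ▸ hxS
      refine ⟨x, by simp, hxS, ?_⟩
      have := hU _ (hp _ (List.prefix_refl _)) S hS
      convert this using 1
      ext y
      have : y ∈ w → y ∈ S := fun hy => hw (by simpa using hy)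
      simp only [Finset.mem_union, Finset.mem_insert, List.mem_toFinset, List.mem_append,
        List.mem_singleton]
      tauto
    · obtain ⟨y, hy, h⟩ := ih (fun p hpw => hp p (hpw.trans (List.prefix_append _ _))) hw
      exact ⟨y, by simp [hy], h⟩

theorem aux_word {α : Type*} [DecidableEq α] {F : Set (Finset α)} (h0 : ∅ ∈ F)
    (hA : ∀ A ∈ F, A ≠ ∅ → ∃ x ∈ A, A.erase x ∈ F) : ∀ (n : ℕ) (A : Finset α), A.card = n → A ∈ F →
      ∃ w : List α, (w.Nodup ∧ ∀ p, p <+: w → p.toFinset ∈ F) ∧ w.toFinset = A := by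
  intro n
  induction n with
  | zero =>
    intro A hc _
    rw [Finset.card_eq_zero] at hc
    exact ⟨[], ⟨by simp, by simpa using h0⟩, by simp [hc]⟩
  | succ n ih =>
    intro A hc hAF
    obtain ⟨x, hx, hxF⟩ := hA A hAF (by rintro rfl; simp at hc)
    obtain ⟨w, ⟨hw, hp⟩, he⟩ := ih (A.erase x) (by rw [Finset.card_erase_of_mem hx]; omega) hxF
    have hxw : x ∉ w := by rw [← List.mem_toFinset, he]; simp
    have hs : (w ++ [x]).toFinset = A := by
      rw [List.toFinset_append, he]
      ext y
      simp only [Finset.mem_union, Finset.mem_erase, List.mem_toFinset, List.mem_singleton]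
      grind
    refine ⟨w ++ [x], ⟨by rw [List.nodup_append]; simp [hw]; grind, ?_⟩, hs⟩
    intro p hpp
    rw [List.prefix_concat_iff] at hpp
    rcases hpp with rfl | hpp
    · rw [hs]; exact hAF
    · exact hp p hpp

theorem aux_antimatroid {α : Type*} [DecidableEq α] {F : Set (Finset α)} (h0 : ∅ ∈ F)
    (hU : ∀ A ∈ F, ∀ B ∈ F, A ∪ B ∈ F) :
    IsAntimatroid {w : List α | w.Nodup ∧ ∀ p, p <+: w → p.toFinset ∈ F} := by
  refine ⟨⟨[], by simp, by simpa using h0⟩, fun w h => h.1, ?_, ?_, ?_⟩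
  · rintro w v ⟨h, hp⟩
    exact ⟨(List.nodup_append.1 h).1, fun p hpw => hp p (hpw.trans (List.prefix_append _ _))⟩
  · rintro w ⟨hw, hpw⟩ v ⟨hv, hpv⟩ hl
    obtain ⟨x, hx, hxv, hxF⟩ := aux_exch hU v.toFinset (hpv v (List.prefix_refl _)) w hpw (by
      intro hs
      have := Finset.card_le_card hs
      rw [List.toFinset_card_of_nodup hw, List.toFinset_card_of_nodup hv] at this
      omega)
    refine ⟨x, hx, ?_, ?_⟩
    · rw [List.mem_toFinset] at hxv
      rw [List.nodup_append]; simp [hv]; grind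
    · intro p hpp
      rw [List.prefix_concat_iff] at hpp
      rcases hpp with rfl | hpp
      · convert hxF using 1
        ext y; simp
      · exact hpv p hpp
  · rintro w v x ⟨hwx, hpwx⟩ ⟨hwv, hpwv⟩ hx
    refine ⟨?_, ?_⟩
    · have hxw : x ∉ w := by
        rw [List.nodup_append] at hwx
        intro h
        exact hwx.2.2 x h x (by simp) rfl
      rw [List.nodup_append]
      refine ⟨hwv, by simp, ?_⟩
      intro a ha b hb
      simp only [List.mem_append, List.mem_singleton] at ha hb
      grind
    · intro p hpp
      rw [List.prefix_concat_iff] at hpp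
      rcases hpp with rfl | hpp
      · convert hU _ (hpwv _ (List.prefix_refl _)) _ (hpwx _ (List.prefix_refl _)) using 1
        ext y; simp; tauto
      · exact hpwv p hpp

theorem stmt_14 {α : Type*} [Fintype α] [DecidableEq α] [Nonempty α]
    (F : Set (Finset α)) :
    (∃ L : Set (List α), IsAntimatroid L ∧ F = FeasibleSets L) ↔
    IsConvexGeometrySet {B | ∃ A ∈ F, B = Finset.univ \ A} := by
  constructor
  · rintro ⟨L, hL, rfl⟩
    refine ⟨?_, ?_, ?_⟩
    · obtain ⟨w, hw⟩ := hL.1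
      exact ⟨∅, ⟨[], hL.2.2.1 [] w (by simpa using hw), by simp⟩, by simp⟩
    · rintro _ ⟨A, ⟨a, ha, rfl⟩, rfl⟩ _ ⟨B, hB, rfl⟩
      refine ⟨_, aux_union hL B hB a ha, ?_⟩
      ext y; simp
    · rintro _ ⟨A, ⟨a, ha, rfl⟩, rfl⟩ hne
      rcases List.eq_nil_or_concat a with rfl | ⟨b, x, rfl⟩
      · simp at hne
      · simp only [List.concat_eq_append] at *
        have hn := hL.2.1 _ ha
        have hxb : x ∉ b := by
          rw [List.nodup_append] at hn
          intro h
          exact hn.2.2 x h x (by simp) rfl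
        refine ⟨x, by simp, _, ⟨b, hL.2.2.1 _ _ ha, rfl⟩, ?_⟩
        ext y
        simp
        grind
  · rintro ⟨h1, h2, h3⟩
    have h0 : ∅ ∈ F := by
      obtain ⟨A, hA, he⟩ := h1
      have : A = ∅ := by
        ext y
        have := Finset.ext_iff.1 he y
        simp at this
        simp [this]
      exact this ▸ hA
    have hU : ∀ A ∈ F, ∀ B ∈ F, A ∪ B ∈ F := by
      intro A hA B hB
      obtain ⟨C, hC, he⟩ := h2 _ ⟨A, hA, rfl⟩ _ ⟨B, hB, rfl⟩
      have : A ∪ B = C := by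
        ext y
        have := Finset.ext_iff.1 he y
        simp at this
        simp only [Finset.mem_union]
        tauto
      exact this ▸ hC
    have hA : ∀ A ∈ F, A ≠ ∅ → ∃ x ∈ A, A.erase x ∈ F := by
      intro A hA hne
      obtain ⟨x, hx, C, hC, he⟩ := h3 _ ⟨A, hA, rfl⟩ (by
        intro h
        apply hne
        ext y
        have := Finset.ext_iff.1 h y
        simp at this
        simp [this])
      refine ⟨x, by simpa using hx, ?_⟩
      have : A.erase x = C := by
        ext y
        have := Finset.ext_iff.1 he y
        simp at this
        simp only [Finset.mem_erase]
        tauto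
      exact this ▸ hC
    refine ⟨_, aux_antimatroid h0 hU, ?_⟩
    ext A
    constructor
    · intro h
      obtain ⟨w, hw, he⟩ := aux_word h0 hA _ A rfl h
      exact ⟨w, hw, he⟩
    · rintro ⟨w, hw, rfl⟩
      exact hw.2 w (List.prefix_refl _)
end

section
/- Let F be a CNF formula on a finite variable set V and let a be a valid partial assignment for F with N(a) nonempty. Then the collection N = {N(b) : b is a valid partial assignment with b ≤ a in P(F)} is the collection of closed sets of a convex geometry on the ground set N(a); that is: (N1) N(a) ∈ N; (N2) if A, B ∈ N then A ∩ B ∈ N; (N3) for every A ∈ N with A ≠ N(a) there is an x ∈ N(a) \ A such that A ∪ {x} ∈ N. -/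
open scoped Classical

/-- A clause (finite set of literals) is invalid under the partial assignment `b` if none of
its literals is satisfied by `b` and at most one of its literals is unassigned. -/
def ClauseInvalid {V : Type*} (b : V → Option Bool) (c : Finset (V × Bool)) : Prop :=
  (∀ l ∈ c, b l.1 ≠ some l.2) ∧ (c.filter (fun l => b l.1 = none)).card ≤ 1

/-- The partial assignment `b` is valid for the CNF formula `F` if no clause of `F` is
invalid under `b`. -/
def ValidFor {V : Type*} (F : Finset (Finset (V × Bool))) (b : V → Option Bool) : Prop :=
  ∀ c ∈ F, ¬ ClauseInvalid b c

/-- The set `N(b)` of assigned variables of `b`. -/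
def assigned {V : Type*} [Fintype V] (b : V → Option Bool) : Finset V :=
  Finset.univ.filter (fun v => b v ≠ none)

/-- The set `S(b)` of star (unassigned) variables of `b`. -/
def stars {V : Type*} [Fintype V] (b : V → Option Bool) : Finset V :=
  Finset.univ.filter (fun v => b v = none)

/-- The set `U(b)` of unconstrained variables of `b`: assigned variables that may be
changed to `*` keeping the assignment valid. -/
noncomputable def unconstrained {V : Type*} [Fintype V] [DecidableEq V]
    (F : Finset (Finset (V × Bool))) (b : V → Option Bool) : Finset V :=
  Finset.univ.filter (fun v => b v ≠ none ∧ ValidFor F (Function.update b v none))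

/-- One covering step in the poset `P(F)`: the valid partial assignment `b'` is obtained
from the valid partial assignment `b` by changing the value of exactly one assigned
variable to `*`. -/
def CoverStep {V : Type*} (F : Finset (Finset (V × Bool))) (b b' : V → Option Bool) : Prop :=
  ValidFor F b ∧ ValidFor F b' ∧
    ∃ v, b v ≠ none ∧ b' v = none ∧ ∀ u, u ≠ v → b' u = b u

/-- `b ≤ a` in the poset `P(F)` of valid partial assignments: the reflexive-transitive
closure of the covering relation. -/
def BelowIn {V : Type*} (F : Finset (Finset (V × Bool))) (a b : V → Option Bool) : Prop :=
  Relation.ReflTransGen (fun x y => CoverStep F x y) a b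

theorem valid_aux {V : Type*} [DecidableEq V] (F : Finset (Finset (V × Bool)))
    (b c : V → Option Bool) (v : V) (hbc : ∀ u, b u = none ∨ b u = c u)
    (hb : ValidFor F b) (hc : ValidFor F (Function.update c v none)) :
    ValidFor F (Function.update b v none) := by
  intro cl hcl hinv
  obtain ⟨h1, h2⟩ := hinv
  by_cases hl : ∃ l ∈ cl, b l.1 = some l.2
  · obtain ⟨l, hlc, hl⟩ := hl
    have hlv : l.1 = v := by
      by_contra hne
      exact h1 l hlc (by rw [Function.update_of_ne hne]; exact hl)
    rw [Finset.card_le_one] at h2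
    have key : ∀ m ∈ cl, m ≠ l → m.1 ≠ v ∧ c m.1 = b m.1 ∧ b m.1 ≠ none ∧ b m.1 ≠ some m.2 := by
      intro m hm hml
      have hn : Function.update b v none m.1 ≠ none := by
        intro hn
        exact hml (h2 m (by simp only [Finset.mem_filter]; exact ⟨hm, hn⟩) l
          (by simp only [Finset.mem_filter]; exact ⟨hlc, by rw [hlv]; simp⟩))
      have hmv : m.1 ≠ v := by
        intro hmv
        apply hn
        rw [hmv]; simp
      have h1m := h1 m hm
      rw [Function.update_of_ne hmv] at hn h1m
      exact ⟨hmv, ((hbc m.1).resolve_left hn).symm, hn, h1m⟩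
    apply hc cl hcl
    refine ⟨?_, ?_⟩
    · intro m hm
      by_cases hml : m = l
      · rw [hml, hlv]; simp
      · obtain ⟨k1, k2, k3, k4⟩ := key m hm hml
        rw [Function.update_of_ne k1, k2]; exact k4
    · have : ∀ x ∈ cl, Function.update c v none x.1 = none → x = l := by
        intro x hx hxn
        by_contra hml
        obtain ⟨k1, k2, k3, k4⟩ := key x hx hml
        rw [Function.update_of_ne k1, k2] at hxn
        exact k3 hxn
      rw [Finset.card_le_one]
      intro x hx y hy
      simp only [Finset.mem_filter] at hx hy
      rw [this x hx.1 hx.2, this y hy.1 hy.2]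
  · push Not at hl
    refine hb cl hcl ⟨hl, le_trans (Finset.card_le_card ?_) h2⟩
    intro x hx
    simp only [Finset.mem_filter] at hx ⊢
    refine ⟨hx.1, ?_⟩
    by_cases hxv : x.1 = v
    · rw [hxv]; simp
    · rw [Function.update_of_ne hxv]; exact hx.2

theorem below_sub {V : Type*} (F : Finset (Finset (V × Bool))) (a b : V → Option Bool)
    (h : BelowIn F a b) : ∀ u, b u = none ∨ b u = a u := by
  induction h with
  | refl => intro u; exact Or.inr rfl
  | tail _ hs ih =>
    obtain ⟨_, _, v, _, hv, hu⟩ := hs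
    intro u
    by_cases huv : u = v
    · left; rw [huv]; exact hv
    · rw [hu u huv]; exact ih u

theorem meet_aux {V : Type*} [DecidableEq V] (F : Finset (Finset (V × Bool)))
    (a b c : V → Option Bool) (hbv : ValidFor F b) (hb : BelowIn F a b) (hc : BelowIn F a c) :
    ValidFor F (fun u => if c u = none then none else b u) ∧
    BelowIn F b (fun u => if c u = none then none else b u) := by
  have hba := below_sub F a b hb
  induction hc with
  | refl =>
    have : (fun u => if a u = none then none else b u) = b := by
      funext u
      have := hba u
      split_ifs with h
      · rw [h] at this; exact (by simpa using this : b u = none).symm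
      · rfl
    rw [this]
    exact ⟨hbv, Relation.ReflTransGen.refl⟩
  | @tail c d hac hs ih =>
    have hca := below_sub F a c hac
    obtain ⟨_, hdv, v, hcv, hdn, hu⟩ := hs
    obtain ⟨ih1, ih2⟩ := ih
    have hd : d = Function.update c v none := by
      funext u
      by_cases h : u = v
      · rw [h, hdn]; simp
      · rw [Function.update_of_ne h, hu u h]
    have hm : (fun u => if d u = none then none else b u) =
        Function.update (fun u => if c u = none then none else b u) v none := by
      funext u
      by_cases h : u = v
      · rw [h, hdn]; simp
      · rw [Function.update_of_ne h, hu u h]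
    have hval := valid_aux F (fun u => if c u = none then none else b u) c v (by
      intro u
      have h1 := hba u
      have h2 := hca u
      split_ifs with h
      · exact Or.inl rfl
      · rw [h2.resolve_left h]; exact h1) ih1 (hd ▸ hdv)
    rw [hm]
    refine ⟨hval, ?_⟩
    by_cases hbn : b v = none
    · have : Function.update (fun u => if c u = none then none else b u) v none =
          (fun u => if c u = none then none else b u) := by
        apply Function.update_eq_self_iff.2
        simp [hbn]
      rw [this]; exact ih2
    · refine Relation.ReflTransGen.tail ih2 ⟨ih1, hval, v, ?_, ?_, ?_⟩
      · simp [hcv, hbn]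
      · simp
      · intro u h
        rw [Function.update_of_ne h]

theorem stmt_15 {V : Type*} [Fintype V] [DecidableEq V]
    (F : Finset (Finset (V × Bool))) (hF : ∀ c ∈ F, c.Nonempty)
    (a : V → Option Bool) (ha : ValidFor F a) (hne : (assigned a).Nonempty)
    (N : Set (Finset V))
    (hNdef : N = {S | ∃ b : V → Option Bool, ValidFor F b ∧ BelowIn F a b ∧ assigned b = S}) :
    assigned a ∈ N ∧
    (∀ A ∈ N, ∀ B ∈ N, A ∩ B ∈ N) ∧
    (∀ A ∈ N, A ≠ assigned a → ∃ x ∈ assigned a \ A, insert x A ∈ N) := by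
  subst hNdef
  refine ⟨⟨a, ha, Relation.ReflTransGen.refl, rfl⟩, ?_, ?_⟩
  · rintro A ⟨b, hbv, hb, rfl⟩ B ⟨c, hcv, hc, rfl⟩
    obtain ⟨h1, h2⟩ := meet_aux F a b c hbv hb hc
    refine ⟨_, h1, Relation.ReflTransGen.trans hb h2, ?_⟩
    ext u
    simp only [assigned, Finset.mem_filter, Finset.mem_inter, Finset.mem_univ, true_and]
    split_ifs with h <;> simp [h]
  · rintro A ⟨b, hbv, hb, rfl⟩ hA
    rcases Relation.ReflTransGen.cases_tail hb with h | ⟨c, hac, hcv, _, v, hcn, hbn, hu⟩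
    · exact absurd (by rw [h]) hA
    · refine ⟨v, ?_, c, hcv, hac, ?_⟩
      · have := (below_sub F a c hac v).resolve_left hcn
        simp only [assigned, Finset.mem_sdiff, Finset.mem_filter, Finset.mem_univ, true_and]
        exact ⟨this ▸ hcn, by simp [hbn]⟩
      · ext u
        simp only [assigned, Finset.mem_insert, Finset.mem_filter, Finset.mem_univ, true_and]
        by_cases h : u = v
        · subst h; simp [hcn]
        · simp [h, hu u h]
end

section
/- For every convex geometry (E, N) on a finite nonempty set E, there exist a CNF formula F on the variable set E and a valid partial assignment a for F such that N(a) = E and N = {N(b) : b is a valid partial assignment with b ≤ a in P(F)}. -/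
open scoped Classical

/-- True on `S`, unassigned elsewhere. -/
noncomputable def bS {E : Type*} (S : Finset E) : E → Option Bool :=
  fun v => if v ∈ S then some true else none

/-- The clause of the implication `C → x`. -/
noncomputable def impl {E : Type*} (C : Finset E) (x : E) : Finset (E × Bool) :=
  insert (x, true) (C.image (fun y => (y, false)))

theorem invalid_iff {E : Type*} (T C : Finset E) (x : E) :
    ClauseInvalid (bS T) (impl C x) ↔ C ⊆ T ∧ x ∉ T := by
  constructor
  · rintro ⟨h1, h2⟩
    have hx : x ∉ T := by
      intro hx
      exact h1 (x, true) (by simp [impl]) (by simp [bS, hx])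
    refine ⟨?_, hx⟩
    intro y hy
    by_contra hyT
    rw [Finset.card_le_one] at h2
    have := h2 (x, true) (by simp [impl, bS, hx]) (y, false) (by simp [impl, bS, hy, hyT])
    simp at this
  · rintro ⟨h1, h2⟩
    constructor
    · intro l hl
      simp only [impl, Finset.mem_insert, Finset.mem_image] at hl
      rcases hl with rfl | ⟨y, hy, rfl⟩
      · simp [bS, h2]
      · simp [bS, h1 hy]
    · have key : ∀ l ∈ (impl C x).filter (fun l => bS T l.1 = none), l = (x, true) := by
        intro l hl
        rw [Finset.mem_filter] at hl
        obtain ⟨hl, hn⟩ := hl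
        simp only [impl, Finset.mem_insert, Finset.mem_image] at hl
        rcases hl with rfl | ⟨y, hy, rfl⟩
        · rfl
        · simp [bS, h1 hy] at hn
      rw [Finset.card_le_one]
      intro p hp q hq
      rw [key p hp, key q hq]

theorem stmt_16 {E : Type*} [Fintype E] [DecidableEq E] [Nonempty E]
    (N : Set (Finset E))
    (hN1 : Finset.univ ∈ N)
    (hN2 : ∀ A ∈ N, ∀ B ∈ N, A ∩ B ∈ N)
    (hN3 : ∀ A ∈ N, A ≠ Finset.univ → ∃ x ∉ A, insert x A ∈ N) :
    ∃ (F : Finset (Finset (E × Bool))) (a : E → Option Bool),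
      (∀ c ∈ F, c.Nonempty) ∧ ValidFor F a ∧ assigned a = Finset.univ ∧
      N = {S | ∃ b : E → Option Bool, ValidFor F b ∧ BelowIn F a b ∧ assigned b = S} := by
  let F : Finset (Finset (E × Bool)) := Finset.univ.filter
    (fun c => ∃ C x, c = impl C x ∧ ∀ A ∈ N, C ⊆ A → x ∈ A)
  have hval : ∀ S : Finset E, ValidFor F (bS S) ↔ S ∈ N := by
    intro S
    constructor
    · intro h
      have hK : (Finset.univ.filter (fun A : Finset E => A ∈ N ∧ S ⊆ A)).inf id ∈ N := by
        apply Finset.inf_induction (p := fun A => A ∈ N)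
        · exact hN1
        · exact hN2
        · intro b hb
          exact (Finset.mem_filter.1 hb).2.1
      have hKS : (Finset.univ.filter (fun A : Finset E => A ∈ N ∧ S ⊆ A)).inf id = S := by
        apply le_antisymm
        · intro x hx
          by_contra hxS
          refine h (impl S x) ?_ ((invalid_iff S S x).2 ⟨subset_rfl, hxS⟩)
          refine Finset.mem_filter.2 ⟨Finset.mem_univ _, S, x, rfl, ?_⟩
          intro A hA hSA
          have hle : (Finset.univ.filter (fun A : Finset E => A ∈ N ∧ S ⊆ A)).inf id ≤ A :=
            Finset.inf_le (f := id) (Finset.mem_filter.2 ⟨Finset.mem_univ A, hA, hSA⟩)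
          exact hle hx
        · apply Finset.le_inf
          intro A hA
          exact (Finset.mem_filter.1 hA).2.2
      rwa [hKS] at hK
    · intro hS c hc hinv
      obtain ⟨-, C, x, rfl, hCx⟩ := Finset.mem_filter.1 hc
      rw [invalid_iff] at hinv
      exact hinv.2 (hCx S hS hinv.1)
  have hass : ∀ S : Finset E, assigned (bS S) = S := by
    intro S
    ext v
    simp [assigned, bS]
  have hbelow : ∀ n : ℕ, ∀ S ∈ N, Sᶜ.card = n → BelowIn F (bS Finset.univ) (bS S) := by
    intro n
    induction n with
    | zero =>
      intro S _ hc
      have : S = Finset.univ := by simpa using hc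
      subst this
      exact Relation.ReflTransGen.refl
    | succ n ih =>
      intro S hS hc
      have hne : S ≠ Finset.univ := by
        rintro rfl
        simp at hc
      obtain ⟨x, hx, hxN⟩ := hN3 S hS hne
      have hcard : (insert x S)ᶜ.card = n := by
        rw [Finset.compl_insert, Finset.card_erase_of_mem (by simpa using hx), hc]
        rfl
      refine Relation.ReflTransGen.tail (ih _ hxN hcard) ⟨(hval _).2 hxN, (hval _).2 hS, x, ?_, ?_, ?_⟩
      · simp [bS]
      · simp [bS, hx]
      · intro u hu
        simp [bS, hu]
  refine ⟨F, bS Finset.univ, ?_, (hval _).2 hN1, hass _, ?_⟩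
  · intro c hc
    obtain ⟨-, C, x, rfl, -⟩ := Finset.mem_filter.1 hc
    exact ⟨(x, true), by simp [impl]⟩
  · ext S
    constructor
    · intro hS
      exact ⟨bS S, (hval S).2 hS, hbelow _ S hS rfl, hass S⟩
    · rintro ⟨b, hb, hab, rfl⟩
      have hform : b = bS (assigned b) := by
        have h : ∀ v, b v = some true ∨ b v = none := by
          clear hb
          induction hab with
          | refl => intro v; simp [bS]
          | tail _ hs ih =>
            obtain ⟨-, -, w, -, h2, h3⟩ := hs
            intro v
            by_cases hv : v = w
            · subst hv; exact Or.inr h2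
            · rw [h3 v hv]; exact ih v
        funext v
        rcases h v with h | h <;> simp [bS, assigned, h]
      rw [hform] at hb
      exact (hval _).1 hb
end

section
/- Let F be a CNF formula on a finite nonempty variable set V, let a be a satisfying assignment of F (a valid partial assignment with no unassigned variables), and let (p_i)_{i∈V} and (q_i)_{i∈V} be real numbers with p_i + q_i = 1 for every i ∈ V. Then ∑_{b ≤ a} ( ∏_{i ∈ S(b)} p_i · ∏_{j ∈ U(b)} q_j ) = 1, where the sum ranges over all valid partial assignments b with b ≤ a in P(F). -/
open scoped Classical

def resA {V : Type*} [DecidableEq V] (a : V → Option Bool) (S : Finset V) : V → Option Bool :=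
  fun v => if v ∈ S then none else a v

inductive Reach {V : Type*} [DecidableEq V] (P : Finset V → Prop) : Finset V → Prop
  | empty : Reach P ∅
  | step (S : Finset V) (v : V) : Reach P S → v ∉ S → P (insert v S) → Reach P (insert v S)

theorem update_resA {V : Type*} [DecidableEq V] (a : V → Option Bool) (S : Finset V) (v : V) :
    Function.update (resA a S) v none = resA a (insert v S) := by
  funext u
  by_cases h : u = v
  · subst h; simp [resA]
  · simp [resA, h]

theorem stars_resA {V : Type*} [Fintype V] [DecidableEq V] (a : V → Option Bool)
    (ha : ∀ v, a v ≠ none) (S : Finset V) : stars (resA a S) = S := by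
  ext v
  simp [stars, resA, ha]

theorem resA_ne {V : Type*} [DecidableEq V] (a : V → Option Bool)
    (ha : ∀ v, a v ≠ none) (S : Finset V) (v : V) : resA a S v ≠ none ↔ v ∉ S := by
  simp [resA, ha]

theorem exchange {V : Type*} [DecidableEq V] (F : Finset (Finset (V × Bool)))
    (a : V → Option Bool) (ha : ∀ v, a v ≠ none) (S T : Finset V) (hST : S ⊆ T) (v : V)
    (hv : v ∉ T) (hT : ValidFor F (resA a T)) (hS : ValidFor F (resA a (insert v S))) :
    ValidFor F (resA a (insert v T)) := by
  intro c hc ⟨h1, h2⟩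
  have hn : ∀ R : Finset V, ∀ l : V × Bool, resA a R l.1 = none ↔ l.1 ∈ R := by
    intro R l; simp [resA, ha]
  simp only [hn] at h2
  by_cases hvc : ∃ l ∈ c, l.1 = v
  · obtain ⟨l, hl, hlv⟩ := hvc
    refine hS c hc ⟨?_, ?_⟩
    · intro m hm hms
      have h3 := h1 m hm
      have hmS : m.1 ∉ insert v S := by
        intro h; simp [resA, h] at hms
      by_cases hmT : m.1 ∈ insert v T
      · have := Finset.card_le_one.1 h2 l (by simp [hl, hlv]) m (by simp only [Finset.mem_filter]; exact ⟨hm, hmT⟩)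
        subst this
        exact hmS (by simp [hlv])
      · apply h3
        simpa [resA, hmS, hmT] using hms
    · simp only [hn]
      refine le_trans (Finset.card_le_card ?_) h2
      intro m
      simp only [Finset.mem_filter]
      exact fun ⟨x, y⟩ => ⟨x, Finset.insert_subset_insert v hST y⟩
  · push Not at hvc
    refine hT c hc ⟨?_, ?_⟩
    · intro m hm hms
      apply h1 m hm
      simpa [resA, hvc m hm] using hms
    · simp only [hn]
      refine le_trans (Finset.card_le_card ?_) h2
      intro m
      simp only [Finset.mem_filter]
      exact fun ⟨x, y⟩ => ⟨x, Finset.mem_insert_of_mem y⟩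

theorem below_iff {V : Type*} [DecidableEq V] (F : Finset (Finset (V × Bool)))
    (a : V → Option Bool) (ha : ∀ v, a v ≠ none) (hV : ValidFor F a) (b : V → Option Bool) :
    (ValidFor F b ∧ BelowIn F a b) ↔
      ∃ S, Reach (fun S => ValidFor F (resA a S)) S ∧ resA a S = b := by
  constructor
  · rintro ⟨-, h⟩
    induction h with
    | refl => exact ⟨∅, Reach.empty, by funext v; simp [resA]⟩
    | @tail b0 c0 _ h ih =>
      obtain ⟨S, hS, rfl⟩ := ih
      obtain ⟨_, h2, v, h3, h4, h5⟩ := h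
      have : resA a (insert v S) = c0 := by
        rw [← update_resA]
        exact (Function.eq_update_iff.2 ⟨h4, h5⟩).symm
      refine ⟨insert v S, Reach.step S v hS ((resA_ne a ha S v).1 h3) ?_, this⟩
      simpa only [this] using h2
  · rintro ⟨S, hS, rfl⟩
    induction hS with
    | empty =>
      have : resA a ∅ = a := by funext v; simp [resA]
      rw [this]
      exact ⟨hV, Relation.ReflTransGen.refl⟩
    | step S v _ hv hP ih =>
      refine ⟨hP, ih.2.tail ⟨ih.1, hP, v, (resA_ne a ha S v).2 hv, by simp [resA], ?_⟩⟩
      intro u hu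
      simp [resA, hu]

theorem reach_P {V : Type*} [DecidableEq V] {P : Finset V → Prop} (h0 : P ∅) {S : Finset V}
    (h : Reach P S) : P S := by
  cases h with
  | empty => exact h0
  | step S v _ _ h => exact h

theorem reach_sub {V : Type*} [DecidableEq V] {P : Finset V → Prop} (h0 : P ∅)
    (hex : ∀ S T v, S ⊆ T → v ∉ T → P T → P (insert v S) → P (insert v T))
    {S T R : Finset V} (hS : Reach P S) (hd : ∀ v ∈ T, v ∉ S → ¬ P (insert v S))
    (hR : Reach P R) (hRT : R ⊆ T) : R ⊆ S := by
  induction hR with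
  | empty => simp
  | step R v _ hv hP ih =>
    have h1 := ih ((Finset.subset_insert v R).trans hRT)
    refine Finset.insert_subset ?_ h1
    by_contra hvS
    exact hd v (hRT (Finset.mem_insert_self v R)) hvS (hex R S v h1 hvS (reach_P h0 hS) hP)

theorem reach_exists {V : Type*} [Fintype V] [DecidableEq V] {P : Finset V → Prop}
    (T : Finset V) :
    ∃ S, Reach P S ∧ S ⊆ T ∧ ∀ v ∈ T, v ∉ S → ¬ P (insert v S) := by
  obtain ⟨S, hS, hm⟩ := Finset.exists_max_image
    (Finset.univ.filter (fun S : Finset V => Reach P S ∧ S ⊆ T)) Finset.card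
    ⟨∅, by simp [Reach.empty]⟩
  simp only [Finset.mem_filter, Finset.mem_univ, true_and] at hS hm
  refine ⟨S, hS.1, hS.2, fun v hv hvS hP => ?_⟩
  have := hm (insert v S) ⟨Reach.step S v hS.1 hvS hP, Finset.insert_subset hv hS.2⟩
  rw [Finset.card_insert_of_notMem hvS] at this
  omega

theorem term_expand {V : Type*} [Fintype V] [DecidableEq V] (p q : V → ℝ)
    (hpq : ∀ i, p i + q i = 1) (S U : Finset V) (hd : Disjoint S U) :
    (∏ i ∈ S, p i) * ∏ j ∈ U, q j = ∑ T : Finset V,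
      if S ⊆ T ∧ Disjoint T U then (∏ i ∈ T, p i) * ∏ j ∈ Finset.univ \ T, q j else 0 := by
  have h := Finset.prod_add (fun i => if i ∈ U then 0 else p i)
    (fun i => if i ∈ S then 0 else q i) (Finset.univ : Finset V)
  rw [Finset.powerset_univ] at h
  have hL : (∏ i ∈ S, p i) * ∏ j ∈ U, q j =
      ∏ i : V, ((if i ∈ U then 0 else p i) + (if i ∈ S then 0 else q i)) := by
    have e1 : ∏ i ∈ S, p i = ∏ i : V, if i ∈ S then p i else 1 := by
      simp [Finset.prod_ite_mem]
    have e2 : ∏ i ∈ U, q i = ∏ i : V, if i ∈ U then q i else 1 := by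
      simp [Finset.prod_ite_mem]
    rw [e1, e2, ← Finset.prod_mul_distrib]
    refine Finset.prod_congr rfl fun i _ => ?_
    by_cases hS : i ∈ S
    · have hU : i ∉ U := Finset.disjoint_left.1 hd hS
      simp [hS, hU]
    · by_cases hU : i ∈ U <;> simp [hS, hU, hpq]
  rw [hL, h]
  refine Finset.sum_congr rfl fun T _ => ?_
  split_ifs with hT
  · congr 1
    · exact Finset.prod_congr rfl fun i hi => if_neg (Finset.disjoint_left.1 hT.2 hi)
    · exact Finset.prod_congr rfl fun i hi => if_neg fun h => (Finset.mem_sdiff.1 hi).2 (hT.1 h)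
  · by_cases h1 : S ⊆ T
    · have h2 : ¬ Disjoint T U := fun h => hT ⟨h1, h⟩
      obtain ⟨i, hi, hU⟩ := Finset.not_disjoint_iff.1 h2
      refine mul_eq_zero_of_left (Finset.prod_eq_zero hi ?_) _
      exact if_pos hU
    · obtain ⟨i, hi, hn⟩ := Finset.not_subset.1 h1
      refine mul_eq_zero_of_right _ (Finset.prod_eq_zero (i := i) (by simp [hn]) ?_)
      exact if_pos hi

theorem stmt_17 {V : Type*} [Fintype V] [DecidableEq V] [Nonempty V]
    (F : Finset (Finset (V × Bool))) (hF : ∀ c ∈ F, c.Nonempty)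
    (a : V → Option Bool) (ha : ValidFor F a) (hsat : stars a = ∅)
    (p q : V → ℝ) (hpq : ∀ i, p i + q i = 1) :
    ∑ b : V → Option Bool,
      (if ValidFor F b ∧ BelowIn F a b then
        (∏ i ∈ stars b, p i) * ∏ j ∈ unconstrained F b, q j
      else 0) = 1 := by
  have hne : ∀ v, a v ≠ none := by
    intro v hv
    have : v ∈ stars a := by simp [stars, hv]
    simp [hsat] at this
  set P : Finset V → Prop := fun S => ValidFor F (resA a S) with hP
  have h0 : P ∅ := by
    have : resA a ∅ = a := by funext v; simp [resA]
    simpa only [hP, this] using ha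
  have hex : ∀ S T v, S ⊆ T → v ∉ T → P T → P (insert v S) → P (insert v T) :=
    fun S T v h1 h2 h3 h4 => exchange F a hne S T h1 v h2 h3 h4
  have hU : ∀ S v, v ∈ unconstrained F (resA a S) ↔ v ∉ S ∧ P (insert v S) := by
    intro S v
    simp only [unconstrained, Finset.mem_filter, Finset.mem_univ, true_and, update_resA,
      resA_ne a hne, hP]
  have hinj : Function.Injective (resA a) := by
    intro S T h
    rw [← stars_resA a hne S, h, stars_resA a hne T]
  rw [← Finset.sum_filter]
  have himg : (Finset.univ.filter (fun b => ValidFor F b ∧ BelowIn F a b)) =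
      (Finset.univ.filter (fun S => Reach P S)).image (resA a) := by
    ext b
    simp only [Finset.mem_filter, Finset.mem_univ, true_and, Finset.mem_image]
    exact below_iff F a hne ha b
  rw [himg, Finset.sum_image (fun x _ y _ h => hinj h)]
  have hterm : ∀ S : Finset V, (∏ i ∈ stars (resA a S), p i) *
      ∏ j ∈ unconstrained F (resA a S), q j = ∑ T : Finset V,
      if S ⊆ T ∧ Disjoint T (unconstrained F (resA a S)) then
        (∏ i ∈ T, p i) * ∏ j ∈ Finset.univ \ T, q j else 0 := by
    intro S
    rw [stars_resA a hne S]
    exact term_expand p q hpq S _ (Finset.disjoint_left.2 fun v hv h => ((hU S v).1 h).1 hv)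
  rw [Finset.sum_congr rfl (fun S _ => hterm S), Finset.sum_comm]
  have hone : ∑ T : Finset V, (∏ i ∈ T, p i) * ∏ j ∈ Finset.univ \ T, q j = 1 := by
    rw [← Finset.powerset_univ, ← Finset.prod_add]
    simp [hpq]
  rw [← hone]
  refine Finset.sum_congr rfl fun T _ => ?_
  have hdis : ∀ S, Disjoint T (unconstrained F (resA a S)) ↔
      ∀ v ∈ T, v ∉ S → ¬ P (insert v S) := by
    intro S
    rw [Finset.disjoint_left]
    simp only [hU, not_and]
  obtain ⟨S, hS, hST, hd⟩ := reach_exists (P := P) T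
  rw [Finset.sum_eq_single S]
  · rw [if_pos ⟨hST, (hdis S).2 hd⟩]
  · intro R hR hne'
    refine if_neg fun ⟨h1, h2⟩ => hne' ?_
    have hR' : Reach P R := (Finset.mem_filter.1 hR).2
    exact Finset.Subset.antisymm (reach_sub h0 hex hS hd hR' h1)
      (reach_sub h0 hex hR' ((hdis R).1 h2) hS hST)
  · intro h
    exact absurd (Finset.mem_filter.2 ⟨Finset.mem_univ _, hS⟩) h
end

section
/- Let F be a CNF formula on a finite nonempty variable set V, let a be a satisfying assignment of F (a valid partial assignment with no unassigned variables), and let p, q be real numbers with p + q = 1. Then ∑_{b ≤ a} p^{|S(b)|} q^{|U(b)|} = 1, where the sum ranges over all valid partial assignments b with b ≤ a in P(F). -/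
open scoped Classical

def starOn {V : Type*} [DecidableEq V] (a : V → Option Bool) (S : Finset V) : V → Option Bool :=
  fun v => if v ∈ S then none else a v

theorem starOn_empty {V : Type*} [DecidableEq V] (a : V → Option Bool) : starOn a ∅ = a := by
  funext v; simp [starOn]

inductive Reach_s18 {V : Type*} [DecidableEq V] (F : Finset (Finset (V × Bool)))
    (a : V → Option Bool) : Finset V → Prop
  | base : Reach_s18 F a ∅
  | step (S : Finset V) (v : V) : Reach_s18 F a S → v ∉ S → ValidFor F (starOn a (insert v S)) →
      Reach_s18 F a (insert v S)

theorem ClauseInvalid.congr' {V : Type*} {b b' : V → Option Bool} {c : Finset (V × Bool)}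
    (h : ∀ l ∈ c, b l.1 = b' l.1) (hb : ClauseInvalid b c) : ClauseInvalid b' c := by
  refine ⟨fun l hl => h l hl ▸ hb.1 l hl, ?_⟩
  have : c.filter (fun l => b' l.1 = none) = c.filter (fun l => b l.1 = none) :=
    Finset.filter_congr (fun l hl => by rw [h l hl])
  rw [this]; exact hb.2

theorem valid_insert {V : Type*} [DecidableEq V] (F : Finset (Finset (V × Bool)))
    (a : V → Option Bool) (X S : Finset V) (v : V) (hXS : X ⊆ S)
    (hS : ValidFor F (starOn a S)) (hX : ValidFor F (starOn a (insert v X))) :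
    ValidFor F (starOn a (insert v S)) := by
  intro c hc hinv
  by_cases hv : ∃ l ∈ c, l.1 = v
  · obtain ⟨l, hl, rfl⟩ := hv
    refine hX c hc (hinv.congr' ?_)
    intro m hm
    by_cases hmS : m.1 ∈ S
    · have := Finset.card_le_one.1 hinv.2 l (by simp [starOn, hl]) m (by simp [starOn, hm, hmS])
      subst this
      simp [starOn]
    · have : m.1 ∉ X := fun h => hmS (hXS h)
      simp [starOn, hmS, this]
  · refine hS c hc (hinv.congr' ?_)
    intro m hm
    have : m.1 ≠ v := fun h => hv ⟨m, hm, h⟩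
    simp [starOn, this]

theorem Reach_s18.valid {V : Type*} [DecidableEq V] {F : Finset (Finset (V × Bool))}
    {a : V → Option Bool} (ha : ValidFor F a) {S : Finset V} (h : Reach_s18 F a S) :
    ValidFor F (starOn a S) := by
  cases h with
  | base => rw [starOn_empty]; exact ha
  | step S v _ _ h => exact h

theorem Reach_s18.belowIn {V : Type*} [DecidableEq V] {F : Finset (Finset (V × Bool))}
    {a : V → Option Bool} (ha : ValidFor F a) (hn : ∀ v, a v ≠ none)
    {S : Finset V} (h : Reach_s18 F a S) :
    BelowIn F a (starOn a S) := by
  induction h with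
  | base => rw [starOn_empty]; exact Relation.ReflTransGen.refl
  | step S v hS hv h ih =>
    refine Relation.ReflTransGen.tail ih ⟨hS.valid ha, h, v, ?_, ?_, ?_⟩
    · simp [starOn, hv, hn]
    · simp [starOn]
    · intro u hu; simp [starOn, hu]

theorem below_reach {V : Type*} [Fintype V] [DecidableEq V] {F : Finset (Finset (V × Bool))}
    {a b : V → Option Bool} (hn : ∀ v, a v ≠ none)
    (h : BelowIn F a b) : Reach_s18 F a (stars b) ∧ b = starOn a (stars b) := by
  induction h with
  | refl =>
    have : stars a = ∅ := by ext v; simp [stars, hn]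
    rw [this]
    exact ⟨Reach_s18.base, (starOn_empty a).symm⟩
  | @tail b b' _ h ih =>
    obtain ⟨h1, h2, v, hv, hv', hu⟩ := h
    have e : stars b' = insert v (stars b) := by
      ext u
      by_cases huv : u = v
      · subst huv; simp [stars, hv']
      · simp [stars, hu u huv, huv]
    have e2 : b' = starOn a (stars b') := by
      funext u
      by_cases huv : u = v
      · subst huv; simp [e, starOn, hv']
      · rw [hu u huv, e]
        conv_lhs => rw [ih.2]
        simp [starOn, huv]
    refine ⟨?_, e2⟩
    rw [e]
    refine Reach_s18.step _ _ ih.1 (by simpa [stars] using hv) ?_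
    rw [← e, ← e2]; exact h2

theorem exists_basis {V : Type*} [Fintype V] [DecidableEq V] (F : Finset (Finset (V × Bool)))
    (a : V → Option Bool) (ha : ValidFor F a) (T : Finset V) :
    ∃! S, Reach_s18 F a S ∧ S ⊆ T ∧
      ∀ v ∈ T, v ∉ S → ¬ ValidFor F (starOn a (insert v S)) := by
  have key : ∀ S, Reach_s18 F a S →
      (∀ v ∈ T, v ∉ S → ¬ ValidFor F (starOn a (insert v S))) →
      ∀ X, Reach_s18 F a X → X ⊆ T → X ⊆ S := by
    intro S hS hmax X hX
    induction hX with
    | base => intro _; simp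
    | step X v hX hv hval ih =>
      intro hT
      have hXS := ih (fun x hx => hT (Finset.mem_insert_of_mem hx))
      refine Finset.insert_subset ?_ hXS
      by_contra hvS
      exact hmax v (hT (Finset.mem_insert_self _ _)) hvS
        (valid_insert F a X S v hXS (hS.valid ha) hval)
  have hne : (Finset.univ.filter (fun S => Reach_s18 F a S ∧ S ⊆ T)).Nonempty :=
    ⟨∅, by simp [Reach_s18.base]⟩
  obtain ⟨S, hS, hmax⟩ := Finset.exists_max_image _ Finset.card hne
  simp only [Finset.mem_filter, Finset.mem_univ, true_and] at hS hmax
  have hS3 : ∀ v ∈ T, v ∉ S → ¬ ValidFor F (starOn a (insert v S)) := by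
    intro v hvT hvS hval
    have := hmax (insert v S) ⟨Reach_s18.step _ _ hS.1 hvS hval, Finset.insert_subset hvT hS.2⟩
    rw [Finset.card_insert_of_notMem hvS] at this
    omega
  refine ⟨S, ⟨hS.1, hS.2, hS3⟩, ?_⟩
  rintro S' ⟨h1, h2, h3⟩
  exact Finset.Subset.antisymm (key S hS.1 hS3 S' h1 h2) (key S' h1 h3 S hS.1 hS.2)

theorem interval_sum {V : Type*} [Fintype V] [DecidableEq V] (S U : Finset V)
    (hSU : Disjoint S U) (p q : ℝ) (hpq : p + q = 1) :
    p ^ S.card * q ^ U.card =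
      ∑ T : Finset V, if S ⊆ T ∧ Disjoint T U then p ^ T.card * q ^ (Tᶜ).card else 0 := by
  have h := Finset.prod_add (fun i : V => if i ∈ U then 0 else p)
    (fun i : V => if i ∈ S then 0 else q) Finset.univ
  have h1 : ∏ i : V, ((if i ∈ U then 0 else p) + (if i ∈ S then 0 else q))
      = p ^ S.card * q ^ U.card := by
    have : ∀ i : V, ((if i ∈ U then 0 else p) + (if i ∈ S then 0 else q))
      = (if i ∈ S then p else 1) * (if i ∈ U then q else 1) := by
      intro i
      by_cases hi : i ∈ S
      · have := Finset.disjoint_left.1 hSU hi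
        simp [hi, this]
      · by_cases hu : i ∈ U <;> simp [hi, hu, hpq]
    simp_rw [this]
    rw [Finset.prod_mul_distrib]
    simp [Finset.prod_ite]
  rw [h1, Finset.powerset_univ] at h
  rw [h]
  refine Finset.sum_congr rfl fun T _ => ?_
  split_ifs with hc
  · have e1 : (∏ i ∈ T, if i ∈ U then 0 else p) = ∏ i ∈ T, p := by
      refine Finset.prod_congr rfl fun i hi => ?_
      simp [Finset.disjoint_left.1 hc.2 hi]
    have e2 : (∏ i ∈ Finset.univ \ T, if i ∈ S then 0 else q) = ∏ i ∈ Finset.univ \ T, q := by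
      refine Finset.prod_congr rfl fun i hi => ?_
      have : i ∉ S := fun h => (Finset.mem_sdiff.1 hi).2 (hc.1 h)
      simp [this]
    rw [e1, e2]
    simp [Finset.compl_eq_univ_sdiff]
  · by_cases hs : S ⊆ T
    · have : ¬ Disjoint T U := fun h => hc ⟨hs, h⟩
      obtain ⟨i, hi, hu⟩ := Finset.not_disjoint_iff.1 this
      rw [Finset.prod_eq_zero hi (by simp [hu]), zero_mul]
    · obtain ⟨i, hi, hu⟩ := Finset.not_subset.1 hs
      rw [Finset.prod_eq_zero (s := Finset.univ \ T) (i := i) (by simp [hu]) (by simp [hi]),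
        mul_zero]

theorem stmt_18 {V : Type*} [Fintype V] [DecidableEq V] [Nonempty V]
    (F : Finset (Finset (V × Bool))) (hF : ∀ c ∈ F, c.Nonempty)
    (a : V → Option Bool) (ha : ValidFor F a) (hsat : stars a = ∅)
    (p q : ℝ) (hpq : p + q = 1) :
    ∑ b : V → Option Bool,
      (if ValidFor F b ∧ BelowIn F a b then
        p ^ (stars b).card * q ^ (unconstrained F b).card
      else 0) = 1 := by
  have hn : ∀ v, a v ≠ none := by
    intro v hv
    have : v ∈ stars a := by simp [stars, hv]
    simp [hsat] at this
  have hstars : ∀ S, stars (starOn a S) = S := by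
    intro S; ext v; simp [stars, starOn, hn]
  have hupd : ∀ S v, Function.update (starOn a S) v none = starOn a (insert v S) := by
    intro S v; funext u
    by_cases h : u = v
    · subst h; simp [starOn]
    · simp [starOn, h]
  have hU : ∀ S v, v ∈ unconstrained F (starOn a S) ↔
      v ∉ S ∧ ValidFor F (starOn a (insert v S)) := by
    intro S v
    simp [unconstrained, hupd, starOn, hn]
  have step1 : ∑ b : V → Option Bool,
      (if ValidFor F b ∧ BelowIn F a b then
        p ^ (stars b).card * q ^ (unconstrained F b).card
      else 0) = ∑ S : Finset V, if Reach_s18 F a S then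
        p ^ S.card * q ^ (unconstrained F (starOn a S)).card else 0 := by
    rw [← Finset.sum_filter, ← Finset.sum_filter]
    refine Finset.sum_bij' (fun b _ => stars b) (fun S _ => starOn a S) ?_ ?_ ?_ ?_ ?_
    · intro b hb
      simp only [Finset.mem_filter, Finset.mem_univ, true_and] at hb ⊢
      exact (below_reach hn hb.2).1
    · intro S hS
      simp only [Finset.mem_filter, Finset.mem_univ, true_and] at hS ⊢
      exact ⟨hS.valid ha, hS.belowIn ha hn⟩
    · intro b hb
      simp only [Finset.mem_filter, Finset.mem_univ, true_and] at hb
      exact (below_reach hn hb.2).2.symm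
    · intro S _; exact hstars S
    · intro b hb
      simp only [Finset.mem_filter, Finset.mem_univ, true_and] at hb
      rw [← (below_reach hn hb.2).2]
  rw [step1]
  have step2 : ∀ S : Finset V, (if Reach_s18 F a S then
        p ^ S.card * q ^ (unconstrained F (starOn a S)).card else 0) =
      ∑ T : Finset V, if Reach_s18 F a S ∧ S ⊆ T ∧
        ∀ v ∈ T, v ∉ S → ¬ ValidFor F (starOn a (insert v S))
        then p ^ T.card * q ^ (Tᶜ).card else 0 := by
    intro S
    by_cases hS : Reach_s18 F a S
    · rw [if_pos hS, interval_sum S _ _ p q hpq]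
      · refine Finset.sum_congr rfl fun T _ => ?_
        refine if_congr ?_ rfl rfl
        simp only [hS, true_and, Finset.disjoint_left, hU, not_and]
      · rw [Finset.disjoint_left]
        intro v hv h
        exact ((hU S v).1 h).1 hv
    · simp [hS]
  rw [Finset.sum_congr rfl fun S _ => step2 S, Finset.sum_comm]
  have step3 : ∀ T : Finset V, (∑ S : Finset V, if Reach_s18 F a S ∧ S ⊆ T ∧
        ∀ v ∈ T, v ∉ S → ¬ ValidFor F (starOn a (insert v S))
        then p ^ T.card * q ^ (Tᶜ).card else 0) = p ^ T.card * q ^ (Tᶜ).card := by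
    intro T
    obtain ⟨S, hS, huniq⟩ := exists_basis F a ha T
    rw [Finset.sum_eq_single S]
    · rw [if_pos hS]
    · intro S' _ hne
      rw [if_neg fun h => hne (huniq S' h)]
    · simp
  rw [Finset.sum_congr rfl fun T _ => step3 T]
  have := interval_sum (∅ : Finset V) ∅ (by simp) p q hpq
  simpa using this.symm
end
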